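/- arXiv:math/0511713 — 3 statements merged into one kernel-verified Lean document; each statement's English description precedes it below -/
import Mathlib

section
/- Let A be an n×(n+1) real matrix, Ã an n×(n+1) matrix over K* with T(Ã) = A, and (S₁,…,S_{n+1}) = Cram_A(Pc(Ã)). Suppose S_j = 0 for some index j while S_i ≠ 0 for some index i. Then the homogeneous system Ã·x = 0 has a one-dimensional solution space, but its solution never tropicalizes to the stable tropical solution: for every nonzero solution x̃ it is NOT the case that all coordinates of x̃ lie in K* and there exists λ ∈ 𝕋 with T(x̃_m) = |A^m|_t + λ for all m (indeed the discrepancy occurs at coordinate j: either x̃_j = 0 or T(x̃_j) − T(x̃_i) ≠ |A^j|_t − |A^i|_t). -/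
open Finset

/-- An algebraically closed field `K` with a nontrivial rank-one valuation `v : K* → ℝ`,
residue field `k` (with residue map `res`, defined on the valuation ring
`{x | x = 0 ∨ 0 ≤ v x}`), and a fixed multiplicative section `sec` of the valuation
(`sec γ` plays the role of `t^γ`). -/
structure TropValField (K k : Type*) [Field K] [Field k] where
  v : K → ℝ
  sec : ℝ → K
  res : K → k
  v_mul : ∀ x y : K, x ≠ 0 → y ≠ 0 → v (x * y) = v x + v y
  v_add : ∀ x y : K, x ≠ 0 → y ≠ 0 → x + y ≠ 0 → min (v x) (v y) ≤ v (x + y)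
  v_nontrivial : ∃ x : K, x ≠ 0 ∧ v x ≠ 0
  sec_ne : ∀ a : ℝ, sec a ≠ 0
  sec_add : ∀ a b : ℝ, sec (a + b) = sec a * sec b
  v_sec : ∀ a : ℝ, v (sec a) = a
  res_add : ∀ x y : K, (x = 0 ∨ 0 ≤ v x) → (y = 0 ∨ 0 ≤ v y) → res (x + y) = res x + res y
  res_mul : ∀ x y : K, (x = 0 ∨ 0 ≤ v x) → (y = 0 ∨ 0 ≤ v y) → res (x * y) = res x * res y
  res_one : res 1 = 1
  res_zero_iff : ∀ x : K, (x = 0 ∨ 0 ≤ v x) → (res x = 0 ↔ x = 0 ∨ 0 < v x)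
  res_surj : Function.Surjective res

/-- The tropicalization map `T x = -v x`. -/
def TropValField.T {K k : Type*} [Field K] [Field k] (V : TropValField K k) (x : K) : ℝ :=
  -(V.v x)

/-- The principal coefficient `Pc x = res (x · t^{-v x}) ∈ k*` of `x ∈ K*`. -/
def TropValField.Pc {K k : Type*} [Field K] [Field k] (V : TropValField K k) (x : K) : k :=
  V.res (x * V.sec (-(V.v x)))

/-- The tropical determinant `|A|_t = max_σ Σ_i A i (σ i)` of a square real matrix. -/
noncomputable def tropDet {n : ℕ} (A : Matrix (Fin n) (Fin n) ℝ) : ℝ :=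
  Finset.univ.sup' ⟨1, Finset.mem_univ 1⟩ fun σ : Equiv.Perm (Fin n) => ∑ i, A i (σ i)

open Classical in
/-- The pseudodeterminant `Δ_A(B)`: the signed sum over those permutations attaining the
tropical determinant of `A` of the corresponding products of entries of `B`. -/
noncomputable def pseudoDet {n : ℕ} {R : Type*} [CommRing R]
    (A : Matrix (Fin n) (Fin n) ℝ) (B : Matrix (Fin n) (Fin n) R) : R :=
  ∑ σ ∈ Finset.univ.filter
      (fun σ : Equiv.Perm (Fin n) => ∑ i, A i (σ i) = tropDet A),
    ((Equiv.Perm.sign σ : ℤ) : R) * ∏ i, B i (σ i)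

/-- Delete the `i`-th column of an `n × (n+1)` matrix. -/
def delCol {n : ℕ} {R : Type*} (A : Matrix (Fin n) (Fin (n + 1)) R) (i : Fin (n + 1)) :
    Matrix (Fin n) (Fin n) R :=
  fun r c => A r (i.succAbove c)

namespace TropValField

variable {K k : Type*} [Field K] [Field k] (V : TropValField K k)

theorem sec_zero : V.sec 0 = 1 := by
  have h := V.sec_add 0 0
  rw [add_zero] at h
  exact (mul_eq_left₀ (V.sec_ne 0)).mp h.symm

theorem sec_sum {ι : Type*} (s : Finset ι) (f : ι → ℝ) :
    V.sec (∑ i ∈ s, f i) = ∏ i ∈ s, V.sec (f i) := by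
  classical
  induction s using Finset.induction_on with
  | empty => simp [V.sec_zero]
  | insert a s ha ih => rw [Finset.sum_insert ha, Finset.prod_insert ha, V.sec_add, ih]

theorem v_one : V.v 1 = 0 := by
  have h := V.v_mul 1 1 one_ne_zero one_ne_zero
  rw [mul_one] at h
  linarith

theorem v_neg_one : V.v (-1) = 0 := by
  have h := V.v_mul (-1) (-1) (neg_ne_zero.mpr one_ne_zero) (neg_ne_zero.mpr one_ne_zero)
  rw [neg_mul_neg, mul_one, V.v_one] at h
  linarith

theorem v_prod {ι : Type*} (s : Finset ι) (f : ι → K) (hf : ∀ i, f i ≠ 0) :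
    V.v (∏ i ∈ s, f i) = ∑ i ∈ s, V.v (f i) := by
  classical
  induction s using Finset.induction_on with
  | empty => simp [V.v_one]
  | insert a s ha ih =>
    rw [Finset.sum_insert ha, Finset.prod_insert ha,
      V.v_mul _ _ (hf a) (Finset.prod_ne_zero_iff.mpr fun i _ => hf i), ih]

/-- The valuation ring `{x | x = 0 ∨ 0 ≤ v x}`. -/
def integers : Subring K where
  carrier := {x | x = 0 ∨ 0 ≤ V.v x}
  zero_mem' := Or.inl rfl
  one_mem' := Or.inr V.v_one.ge
  mul_mem' := by
    intro x y hx hy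
    by_cases hx0 : x = 0
    · exact Or.inl (by simp [hx0])
    by_cases hy0 : y = 0
    · exact Or.inl (by simp [hy0])
    refine Or.inr ?_
    rw [V.v_mul x y hx0 hy0]
    exact add_nonneg (hx.resolve_left hx0) (hy.resolve_left hy0)
  add_mem' := by
    intro x y hx hy
    by_cases hx0 : x = 0
    · simpa [hx0] using hy
    by_cases hy0 : y = 0
    · simpa [hy0] using hx
    by_cases hxy : x + y = 0
    · exact Or.inl hxy
    exact Or.inr ((le_min (hx.resolve_left hx0) (hy.resolve_left hy0)).trans
      (V.v_add x y hx0 hy0 hxy))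
  neg_mem' := by
    intro x hx
    by_cases hx0 : x = 0
    · exact Or.inl (by simp [hx0])
    refine Or.inr ?_
    rw [← neg_one_mul, V.v_mul _ _ (neg_ne_zero.mpr one_ne_zero) hx0, V.v_neg_one, zero_add]
    exact hx.resolve_left hx0

/-- The residue map as a ring homomorphism on the valuation ring. -/
def resHom : V.integers →+* k where
  toFun x := V.res x
  map_one' := V.res_one
  map_mul' x y := V.res_mul x y x.2 y.2
  map_zero' := (V.res_zero_iff 0 (Or.inl rfl)).mpr (Or.inl rfl)
  map_add' x y := V.res_add x y x.2 y.2

theorem mul_sec_T_mem {x : K} (hx : x ≠ 0) : x * V.sec (V.T x) ∈ V.integers := by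
  refine Or.inr ?_
  rw [V.v_mul _ _ hx (V.sec_ne _), V.v_sec, T, add_neg_cancel]

/-- After rescaling by `t^{|A|_t}`, the determinant of a lift of `A` is integral with residue the
pseudodeterminant of the principal coefficients. -/
theorem exists_det_mul_sec {n : ℕ} (A : Matrix (Fin n) (Fin n) ℝ) (B : Matrix (Fin n) (Fin n) K)
    (hne : ∀ r c, B r c ≠ 0) (htrop : ∀ r c, V.T (B r c) = A r c) :
    ∃ d : V.integers, (d : K) = B.det * V.sec (tropDet A) ∧
      V.resHom d = pseudoDet A (fun r c => V.Pc (B r c)) := by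
  classical
  have hprod (σ : Equiv.Perm (Fin n)) : ∏ i, B i (σ i) ≠ 0 :=
    Finset.prod_ne_zero_iff.mpr fun i _ => hne i (σ i)
  have hv (σ : Equiv.Perm (Fin n)) :
      V.v ((∏ i, B i (σ i)) * V.sec (tropDet A)) = tropDet A - ∑ i, A i (σ i) := by
    rw [V.v_mul _ _ (hprod σ) (V.sec_ne _), V.v_sec, V.v_prod _ _ fun i => hne i (σ i)]
    simp only [← htrop, T, Finset.sum_neg_distrib]
    ring
  have hle (σ : Equiv.Perm (Fin n)) : ∑ i, A i (σ i) ≤ tropDet A :=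
    Finset.le_sup' (fun σ : Equiv.Perm (Fin n) => ∑ i, A i (σ i)) (Finset.mem_univ σ)
  let summand (σ : Equiv.Perm (Fin n)) : V.integers :=
    ⟨(∏ i, B i (σ i)) * V.sec (tropDet A), Or.inr (by rw [hv]; linarith [hle σ])⟩
  have hres (σ : Equiv.Perm (Fin n)) : V.resHom (summand σ) =
      if ∑ i, A i (σ i) = tropDet A then ∏ i, V.Pc (B i (σ i)) else 0 := by
    split_ifs with h
    · have hsummand : summand σ = ∏ i, (⟨_, V.mul_sec_T_mem (hne i (σ i))⟩ : V.integers) := by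
        apply Subtype.ext
        simp only [summand, ← h, V.sec_sum, htrop, SubmonoidClass.coe_finsetProd,
          Finset.prod_mul_distrib]
      rw [hsummand, map_prod]
      rfl
    · refine (V.res_zero_iff _ (summand σ).2).mpr (Or.inr ?_)
      simp only [summand]
      rw [hv]
      exact sub_pos.mpr (lt_of_le_of_ne (hle σ) h)
  refine ⟨∑ σ : Equiv.Perm (Fin n), ((Equiv.Perm.sign σ : ℤ) : V.integers) * summand σ, ?_, ?_⟩
  · rw [← Matrix.det_transpose, Matrix.det_apply', Finset.sum_mul]
    simp [summand, mul_assoc]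
  · rw [map_sum]
    unfold pseudoDet
    rw [Finset.sum_filter]
    refine Finset.sum_congr rfl fun σ _ => ?_
    rw [map_mul, map_intCast, hres, mul_ite, mul_zero]

/-- A lift of `A` with nonzero pseudodeterminant has determinant tropicalizing to `|A|_t`. -/
theorem v_det_of_pseudoDet_ne_zero {n : ℕ} (A : Matrix (Fin n) (Fin n) ℝ)
    (B : Matrix (Fin n) (Fin n) K) (hne : ∀ r c, B r c ≠ 0) (htrop : ∀ r c, V.T (B r c) = A r c)
    (h : pseudoDet A (fun r c => V.Pc (B r c)) ≠ 0) :
    B.det ≠ 0 ∧ V.v B.det = -tropDet A := by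
  obtain ⟨d, hd, hres⟩ := V.exists_det_mul_sec A B hne htrop
  rw [← hres] at h
  have hdK : ¬ ((d : K) = 0 ∨ 0 < V.v d) := fun h' => h ((V.res_zero_iff d d.2).mpr h')
  have hmem : (d : K) = 0 ∨ 0 ≤ V.v d := d.2
  push Not at hdK
  have hdet : B.det ≠ 0 := left_ne_zero_of_mul (hd ▸ hdK.1)
  have hv := le_antisymm hdK.2 (hmem.resolve_left hdK.1)
  rw [hd, V.v_mul _ _ hdet (V.sec_ne _), V.v_sec] at hv
  exact ⟨hdet, by linarith⟩

/-- A nonsingular lift of `A` with zero pseudodeterminant has determinant tropicalizing strictly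
below `|A|_t`. -/
theorem neg_tropDet_lt_v_det {n : ℕ} (A : Matrix (Fin n) (Fin n) ℝ)
    (B : Matrix (Fin n) (Fin n) K) (hne : ∀ r c, B r c ≠ 0) (htrop : ∀ r c, V.T (B r c) = A r c)
    (h : pseudoDet A (fun r c => V.Pc (B r c)) = 0) (hdet : B.det ≠ 0) :
    -tropDet A < V.v B.det := by
  obtain ⟨d, hd, hres⟩ := V.exists_det_mul_sec A B hne htrop
  rw [← hres] at h
  have hdK := (V.res_zero_iff d d.2).mp h
  rw [hd, V.v_mul _ _ hdet (V.sec_ne _), V.v_sec] at hdK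
  have := hdK.resolve_left (mul_ne_zero hdet (V.sec_ne _))
  linarith

end TropValField

/-- Homogeneous Cramer's rule: solutions of `M x = 0` are proportional to the signed maximal
minors. -/
theorem det_delCol_mul_eq {R : Type*} [CommRing R] {n : ℕ} (M : Matrix (Fin n) (Fin (n + 1)) R)
    (x : Fin (n + 1) → R) (hx : M.mulVec x = 0) (i j : Fin (n + 1)) :
    (-1) ^ (i : ℕ) * (delCol M i).det * x j = (-1) ^ (j : ℕ) * (delCol M j).det * x i := by
  let B : Matrix (Fin (n + 1)) (Fin (n + 1)) R := Matrix.of (Fin.cons (Pi.single i 1) M)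
  have hB0 : B 0 = Pi.single i 1 := rfl
  have hB : B.mulVec x = Pi.single 0 (x i) := by
    ext r
    refine Fin.cases ?_ (fun r => ?_) r
    · change dotProduct (B 0) x = _
      simp [hB0]
    · exact congrFun hx r
  have hsub (c : Fin (n + 1)) : B.submatrix Fin.succ c.succAbove = delCol M c := rfl
  have hdet : B.det = (-1) ^ (i : ℕ) * (delCol M i).det := by
    rw [Matrix.det_succ_row_zero, Finset.sum_eq_single i]
    · rw [hsub]
      simp [hB0]
    · intro c _ hc
      simp [hB0, Pi.single_eq_of_ne hc]
    · simp
  have hadj : B.adjugate j 0 = (-1) ^ (j : ℕ) * (delCol M j).det := by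
    rw [Matrix.adjugate_fin_succ_eq_det_submatrix, Fin.succAbove_zero, hsub]
    simp
  have h := congrFun (congrArg B.adjugate.mulVec hB) j
  rw [Matrix.mulVec_mulVec, Matrix.adjugate_mul, Matrix.smul_mulVec, Matrix.one_mulVec,
    Matrix.mulVec_single, Pi.smul_apply, smul_eq_mul, hdet] at h
  simpa [hadj] using h

/-- If deleting column `i` leaves a nonsingular matrix, a nonzero solution of `M x = 0` has
nonzero `i`-th coordinate. -/
theorem apply_ne_zero_of_mulVec_eq_zero {F : Type*} [Field F] {n : ℕ}
    (M : Matrix (Fin n) (Fin (n + 1)) F) {i : Fin (n + 1)} (hdet : (delCol M i).det ≠ 0)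
    {x : Fin (n + 1) → F} (hx : M.mulVec x = 0) (hx0 : x ≠ 0) : x i ≠ 0 := by
  contrapose! hx0
  ext m
  simpa [hx0, hdet] using det_delCol_mul_eq M x hx i m

theorem finrank_ker_mulVecLin_eq_one {F : Type*} [Field F] {n : ℕ}
    (M : Matrix (Fin n) (Fin (n + 1)) F) {i : Fin (n + 1)} (hdet : (delCol M i).det ≠ 0) :
    Module.finrank F (LinearMap.ker M.mulVecLin) = 1 := by
  have hker : LinearMap.ker M.mulVecLin ≠ ⊥ :=
    LinearMap.ker_ne_bot_of_finrank_lt (by simp)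
  obtain ⟨y, hy, hy0⟩ := Submodule.exists_mem_ne_zero_of_ne_bot hker
  have hyi := apply_ne_zero_of_mulVec_eq_zero M hdet (x := y) (by simpa using hy) hy0
  refine finrank_eq_one_iff'.mpr ⟨(⟨y, hy⟩ : LinearMap.ker M.mulVecLin),
    fun h => hy0 (congrArg Subtype.val h), fun w => ⟨w.1 i / y i, ?_⟩⟩
  have hmem := sub_mem (Submodule.smul_mem _ (w.1 i / y i) hy) w.2
  apply Subtype.ext
  by_contra hne
  refine apply_ne_zero_of_mulVec_eq_zero M hdet (by simpa using hmem) (sub_ne_zero.mpr hne) ?_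
  simp [hyi]

/-- if some entry `S_j` of `Cram_A(Pc Ã)` vanishes while another entry `S_i`
does not, then `Ã x = 0` still has a unique projective solution, but this solution never
tropicalizes to the stable tropical solution; the discrepancy occurs at coordinate `j`. -/
theorem tropical_cramer_never_lifts
    {K k : Type*} [Field K] [IsAlgClosed K] [Field k] (V : TropValField K k)
    {n : ℕ} (A : Matrix (Fin n) (Fin (n + 1)) ℝ) (At : Matrix (Fin n) (Fin (n + 1)) K)
    (hne : ∀ r c, At r c ≠ 0) (htrop : ∀ r c, V.T (At r c) = A r c)
    (j i : Fin (n + 1))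
    (hj : pseudoDet (delCol A j) (delCol (fun r c => V.Pc (At r c)) j) = 0)
    (hi : pseudoDet (delCol A i) (delCol (fun r c => V.Pc (At r c)) i) ≠ 0) :
    Module.finrank K ↥(LinearMap.ker At.mulVecLin) = 1 ∧
    ∀ x : Fin (n + 1) → K, At.mulVec x = 0 → x ≠ 0 →
      (¬ ((∀ m, x m ≠ 0) ∧ ∃ lam : ℝ, ∀ m, V.T (x m) = tropDet (delCol A m) + lam)) ∧
      (x j = 0 ∨ V.T (x j) - V.T (x i) ≠ tropDet (delCol A j) - tropDet (delCol A i)) := by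
  obtain ⟨hdi, hvi⟩ := V.v_det_of_pseudoDet_ne_zero (delCol A i) (delCol At i)
    (fun _ _ => hne _ _) (fun _ _ => htrop _ _) hi
  refine ⟨finrank_ker_mulVecLin_eq_one At hdi, fun x hx hx0 => ?_⟩
  have key : x j = 0 ∨
      V.T (x j) - V.T (x i) ≠ tropDet (delCol A j) - tropDet (delCol A i) := by
    refine or_iff_not_imp_left.mpr fun hxj => ?_
    have hxi := apply_ne_zero_of_mulVec_eq_zero At hdi hx hx0
    have hsign (m : Fin (n + 1)) : ((-1 : K) ^ (m : ℕ)) ≠ 0 ∧ V.v ((-1) ^ (m : ℕ)) = 0 := by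
      rcases neg_one_pow_eq_or K (m : ℕ) with h | h <;> simp [h, V.v_one, V.v_neg_one]
    have h := det_delCol_mul_eq At x hx i j
    have hdj : (delCol At j).det ≠ 0 := fun h0 => by
      simp [h0, hdi, hxj] at h
    have hvj := V.neg_tropDet_lt_v_det (delCol A j) (delCol At j)
      (fun _ _ => hne _ _) (fun _ _ => htrop _ _) hj hdj
    have hv := congrArg V.v h
    rw [V.v_mul _ _ (mul_ne_zero (hsign i).1 hdi) hxj, V.v_mul _ _ (hsign i).1 hdi, (hsign i).2,
      V.v_mul _ _ (mul_ne_zero (hsign j).1 hdj) hxi, V.v_mul _ _ (hsign j).1 hdj, (hsign j).2]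
      at hv
    unfold TropValField.T
    intro heq
    linarith
  refine ⟨?_, key⟩
  rintro ⟨hxne, lam, hlam⟩
  refine key.resolve_left (hxne j) ?_
  rw [hlam j, hlam i]
  ring
end

section
/- Let k be a field and C₁,…,C_r pairwise disjoint finite sets of variables. For 1 ≤ u ≤ n let F_u = {f_u^1,…,f_u^{n+1}} be nonzero polynomials in k[C₁ ∪ … ∪ C_r] such that: (i) for fixed u, all f_u^l are multihomogeneous in certain variable sets C_{u¹},…,C_{u^{s_u}} with the same multidegree (each f_u^l involves only variables from these sets and is homogeneous of the same fixed degree with respect to each of these sets); (ii) if u ≠ v then F_u and F_v involve disjoint collections of the sets C_i; (iii) for fixed u and l ≠ m, the polynomials f_u^l and f_u^m have no monomial in common. Let B be the n×(n+1) matrix with entry B_{u,l} = f_u^l, let A be any n×(n+1) real matrix, and set (S₁,…,S_{n+1}) = Cram_A(B). Then: (1) S₁,…,S_{n+1} are nonzero multihomogeneous polynomials in the sets C₁,…,C_r with the same multidegree; (2) if σ ≠ τ are permutations both attaining the tropical determinant |A^l|_t (hence both contributing to S_l), then every monomial of Π_{u=1}^n (B^l)_{u,σ(u)} is different from every monomial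 of Π_{u=1}^n (B^l)_{u,τ(u)}; (3) if l ≠ m then S_l and S_m have no common monomials. -/
open Finset

/-- `f` is homogeneous of degree `d` with respect to the set of variables `S`: every
monomial of `f` has total degree `d` in the variables of `S`. -/
def HomogWrt {k Var : Type*} [CommSemiring k] (S : Finset Var) (d : ℕ)
    (f : MvPolynomial Var k) : Prop :=
  ∀ m ∈ f.support, ∑ x ∈ S, m x = d

open MvPolynomial in
/-- Every monomial of a finite product is a product of monomials of the factors. -/
theorem exists_mem_support_of_mem_support_prod {ι k Var : Type*} [Fintype ι] [CommSemiring k]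
    (p : ι → MvPolynomial Var k) {m : Var →₀ ℕ} (hm : m ∈ (∏ i, p i).support) :
    ∃ g : ι → Var →₀ ℕ, (∀ i, g i ∈ (p i).support) ∧ m = ∑ i, g i := by
  classical
  suffices H : ∀ (s : Finset ι) (m : Var →₀ ℕ), m ∈ (∏ i ∈ s, p i).support →
      ∃ g : ι → Var →₀ ℕ, (∀ i ∈ s, g i ∈ (p i).support) ∧ m = ∑ i ∈ s, g i by
    obtain ⟨g, hg, h⟩ := H univ m hm
    exact ⟨g, fun i => hg i (mem_univ i), h⟩
  intro s
  induction s using Finset.induction_on with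
  | empty =>
    intro m hm
    refine ⟨0, by simp, ?_⟩
    by_contra h
    simp only [prod_empty, mem_support_iff, coeff_one] at hm
    exact hm (if_neg fun h' => h (by simp [← h']))
  | insert a s ha ih =>
    intro m hm
    rw [prod_insert ha] at hm
    obtain ⟨x, hx, y, hy, rfl⟩ := Finset.mem_add.1 (support_mul _ _ hm)
    obtain ⟨g, hg, rfl⟩ := ih y hy
    have hne : ∀ i ∈ s, i ≠ a := fun i hi h => ha (h ▸ hi)
    refine ⟨Function.update g a x, fun i hi => ?_, ?_⟩
    · rcases Finset.mem_insert.1 hi with rfl | hi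
      · simpa using hx
      · simpa [hne i hi] using hg i hi
    · rw [sum_insert ha, Function.update_self]
      congr 1
      exact sum_congr rfl fun i hi => by simp [hne i hi]

/-- A sum of exponent vectors supported on pairwise disjoint sets determines its summands. -/
theorem eq_of_sum_eq_sum_of_supported {ι Var : Type*} [Fintype ι] (V : ι → Set Var)
    (hV : ∀ i j, i ≠ j → Disjoint (V i) (V j)) (g h : ι → Var →₀ ℕ)
    (hg : ∀ i x, g i x ≠ 0 → x ∈ V i) (hh : ∀ i x, h i x ≠ 0 → x ∈ V i)
    (e : ∑ i, g i = ∑ i, h i) : g = h := by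
  have key : ∀ g : ι → Var →₀ ℕ, (∀ i x, g i x ≠ 0 → x ∈ V i) →
      ∀ i, ∀ x ∈ V i, (∑ j, g j) x = g i x := by
    intro g hg i x hx
    rw [Finsupp.finsetSum_apply]
    refine sum_eq_single i (fun j _ hj => ?_) (by simp)
    by_contra h0
    exact Set.disjoint_left.1 (hV j i hj) (hg j x h0) hx
  funext i
  ext x
  by_cases hx : x ∈ V i
  · rw [← key g hg i x hx, ← key h hh i x hx, e]
  · rw [not_not.1 (mt (hg i x) hx), not_not.1 (mt (hh i x) hx)]

/-- If the rows of `f` involve pairwise disjoint sets of variables and the entries of each row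
share no monomial, then products along different choices of columns share no monomial. -/
theorem disjoint_support_prod {ι κ k Var : Type*} [Fintype ι] [CommSemiring k]
    (f : ι → κ → MvPolynomial Var k) (V : ι → Set Var)
    (hV : ∀ i j, i ≠ j → Disjoint (V i) (V j))
    (hf : ∀ i l, ∀ m ∈ (f i l).support, ∀ x, m x ≠ 0 → x ∈ V i)
    (hmono : ∀ i, ∀ l m, l ≠ m → Disjoint (f i l).support (f i m).support)
    {a b : ι → κ} (hab : a ≠ b) :
    Disjoint (∏ i, f i (a i)).support (∏ i, f i (b i)).support := by
  refine Finset.disjoint_left.2 fun m hm hm' => ?_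
  obtain ⟨g, hg, rfl⟩ := exists_mem_support_of_mem_support_prod _ hm
  obtain ⟨h, hh, e⟩ := exists_mem_support_of_mem_support_prod _ hm'
  obtain rfl := eq_of_sum_eq_sum_of_supported V hV g h
    (fun i => hf i _ _ (hg i)) (fun i => hf i _ _ (hh i)) e
  obtain ⟨i, hi⟩ := Function.ne_iff.1 hab
  exact Finset.disjoint_left.1 (hmono i _ _ hi) (hg i) (hh i)

/-- Some permutation attains the tropical determinant. -/
theorem exists_sum_eq_tropDet {n : ℕ} (A : Matrix (Fin n) (Fin n) ℝ) :
    ∃ σ : Equiv.Perm (Fin n), ∑ i, A i (σ i) = tropDet A := by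
  obtain ⟨σ, -, h⟩ := exists_mem_eq_sup' (s := univ) ⟨1, mem_univ 1⟩
    fun σ : Equiv.Perm (Fin n) => ∑ i, A i (σ i)
  exact ⟨σ, h.symm⟩

open Classical in
/-- The coefficients of a pseudodeterminant of a matrix of polynomials. -/
theorem coeff_pseudoDet {n : ℕ} {k Var : Type*} [CommRing k] (A : Matrix (Fin n) (Fin n) ℝ)
    (B : Matrix (Fin n) (Fin n) (MvPolynomial Var k)) (m : Var →₀ ℕ) :
    (pseudoDet A B).coeff m =
      ∑ σ ∈ univ.filter (fun σ : Equiv.Perm (Fin n) => ∑ i, A i (σ i) = tropDet A),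
        ((Equiv.Perm.sign σ : ℤ) : k) * (∏ i, B i (σ i)).coeff m := by
  rw [pseudoDet, MvPolynomial.coeff_sum]
  refine sum_congr rfl fun σ _ => ?_
  rw [← map_intCast (MvPolynomial.C (σ := Var) (R := k)), MvPolynomial.coeff_C_mul]

/-- Every monomial of a pseudodeterminant comes from one of its terms. -/
theorem exists_mem_support_prod_of_mem_support_pseudoDet {n : ℕ} {k Var : Type*} [CommRing k]
    {A : Matrix (Fin n) (Fin n) ℝ} {B : Matrix (Fin n) (Fin n) (MvPolynomial Var k)}
    {m : Var →₀ ℕ} (hm : m ∈ (pseudoDet A B).support) :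
    ∃ σ : Equiv.Perm (Fin n), m ∈ (∏ i, B i (σ i)).support := by
  rw [MvPolynomial.mem_support_iff, coeff_pseudoDet] at hm
  obtain ⟨σ, -, h⟩ := exists_ne_zero_of_sum_ne_zero hm
  exact ⟨σ, MvPolynomial.mem_support_iff.2 (right_ne_zero_of_mul h)⟩

/-- A pseudodeterminant is nonzero if the entries are nonzero and its terms share no monomial. -/
theorem pseudoDet_ne_zero {n : ℕ} {k Var : Type*} [CommRing k] [IsDomain k]
    {A : Matrix (Fin n) (Fin n) ℝ} {B : Matrix (Fin n) (Fin n) (MvPolynomial Var k)}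
    (hB : ∀ i j, B i j ≠ 0)
    (hdisj : ∀ σ τ : Equiv.Perm (Fin n), σ ≠ τ →
      Disjoint (∏ i, B i (σ i)).support (∏ i, B i (τ i)).support) :
    pseudoDet A B ≠ 0 := by
  classical
  obtain ⟨σ, hσ⟩ := exists_sum_eq_tropDet A
  obtain ⟨m, hm⟩ := MvPolynomial.support_nonempty.2
    (prod_ne_zero_iff.2 fun i _ => hB i (σ i) : ∏ i, B i (σ i) ≠ 0)
  refine MvPolynomial.ne_zero_iff.2 ⟨m, ?_⟩
  rw [coeff_pseudoDet, sum_eq_single σ]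
  · refine mul_ne_zero ?_ (MvPolynomial.mem_support_iff.1 hm)
    rcases Int.units_eq_one_or (Equiv.Perm.sign σ) with h | h <;> simp [h]
  · intro τ _ hτ
    rw [MvPolynomial.notMem_support_iff.1 (Finset.disjoint_left.1 (hdisj σ τ hτ.symm) hm),
      mul_zero]
  · intro h
    exact absurd (mem_filter.2 ⟨mem_univ σ, hσ⟩) h

/-- structure of the pseudodeterminants `Cram_A(B)` of a matrix `B` whose
rows consist of multihomogeneous polynomials in pairwise disjoint groups of variable sets:
the entries `S_l` are nonzero, multihomogeneous of a common multidegree, distinct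
permutations contribute disjoint sets of monomials, and distinct entries `S_l`, `S_m`
share no monomial. -/
theorem pseudodeterminants_of_multihomogeneous_matrix
    {k Var : Type*} [Field k] {r n : ℕ}
    (C : Fin r → Finset Var)
    (hCdisj : ∀ i j : Fin r, i ≠ j → Disjoint (C i) (C j))
    (f : Matrix (Fin n) (Fin (n + 1)) (MvPolynomial Var k))
    (hne : ∀ u l, f u l ≠ 0)
    (S : Fin n → Finset (Fin r)) (d : Fin n → Fin r → ℕ)
    (hvars : ∀ u l, ∀ m ∈ (f u l).support, ∀ x : Var, m x ≠ 0 → ∃ i ∈ S u, x ∈ C i)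
    (hhomog : ∀ u l, ∀ i ∈ S u, HomogWrt (C i) (d u i) (f u l))
    (hSdisj : ∀ u v : Fin n, u ≠ v → Disjoint (S u) (S v))
    (hmono : ∀ u, ∀ l m : Fin (n + 1), l ≠ m → Disjoint (f u l).support (f u m).support)
    (A : Matrix (Fin n) (Fin (n + 1)) ℝ) :
    -- (1)
    (∃ D : Fin r → ℕ, ∀ l : Fin (n + 1),
        pseudoDet (delCol A l) (delCol f l) ≠ 0 ∧
        ∀ i : Fin r, HomogWrt (C i) (D i) (pseudoDet (delCol A l) (delCol f l))) ∧
    -- (2)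
    (∀ l : Fin (n + 1), ∀ σ τ : Equiv.Perm (Fin n),
        (∑ u, delCol A l u (σ u) = tropDet (delCol A l)) →
        (∑ u, delCol A l u (τ u) = tropDet (delCol A l)) → σ ≠ τ →
        Disjoint (∏ u, delCol f l u (σ u)).support (∏ u, delCol f l u (τ u)).support) ∧
    -- (3)
    (∀ l m : Fin (n + 1), l ≠ m →
        Disjoint (pseudoDet (delCol A l) (delCol f l)).support
          (pseudoDet (delCol A m) (delCol f m)).support) := by
  classical
  have hVdisj : ∀ u v, u ≠ v →
      Disjoint {x : Var | ∃ i ∈ S u, x ∈ C i} {x : Var | ∃ i ∈ S v, x ∈ C i} := by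
    refine fun u v huv => Set.disjoint_left.2 ?_
    rintro x ⟨i, hi, hxi⟩ ⟨j, hj, hxj⟩
    have hij : i ≠ j := fun h => Finset.disjoint_left.1 (hSdisj u v huv) hi (h ▸ hj)
    exact Finset.disjoint_left.1 (hCdisj i j hij) hxi hxj
  have hprod : ∀ a b : Fin n → Fin (n + 1), a ≠ b →
      Disjoint (∏ u, f u (a u)).support (∏ u, f u (b u)).support :=
    fun a b => disjoint_support_prod f _ hVdisj hvars hmono
  have hperm : ∀ l, ∀ σ τ : Equiv.Perm (Fin n), σ ≠ τ →
      Disjoint (∏ u, delCol f l u (σ u)).support (∏ u, delCol f l u (τ u)).support :=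
    fun l σ τ hστ => hprod (fun u => l.succAbove (σ u)) (fun u => l.succAbove (τ u)) fun h =>
      hστ (Equiv.ext fun u => Fin.succAbove_right_injective (congrFun h u))
  refine ⟨⟨fun i => ∑ u, if i ∈ S u then d u i else 0, fun l =>
    ⟨pseudoDet_ne_zero (fun u c => hne u _) (hperm l), fun i m hm => ?_⟩⟩,
    fun l σ τ _ _ => hperm l σ τ, fun l m hlm => Finset.disjoint_left.2 fun e hl hm => ?_⟩
  · obtain ⟨σ, hσ⟩ := exists_mem_support_prod_of_mem_support_pseudoDet hm
    obtain ⟨g, hg, rfl⟩ := exists_mem_support_of_mem_support_prod _ hσ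
    simp only [Finsupp.finsetSum_apply]
    rw [sum_comm]
    refine sum_congr rfl fun u _ => ?_
    split_ifs with hi
    · exact hhomog u _ i hi _ (hg u)
    · refine sum_eq_zero fun x hx => ?_
      by_contra h0
      obtain ⟨j, hj, hxj⟩ := hvars u _ _ (hg u) x h0
      have hij : i ≠ j := fun h => hi (h ▸ hj)
      exact Finset.disjoint_left.1 (hCdisj i j hij) hx hxj
  · obtain ⟨σ, hσ⟩ := exists_mem_support_prod_of_mem_support_pseudoDet hl
    obtain ⟨τ, hτ⟩ := exists_mem_support_prod_of_mem_support_pseudoDet hm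
    refine Finset.disjoint_left.1 (hprod (fun u => l.succAbove (σ u))
      (fun u => m.succAbove (τ u)) fun h => ?_) hσ hτ
    obtain ⟨c, hc⟩ := Fin.exists_succAbove_eq hlm
    have h' := congrFun h (τ.symm c)
    simp only [Equiv.apply_symm_apply, hc] at h'
    exact Fin.succAbove_ne l _ h'
end

section
/- (Constructive tropical converse Pascal theorem.) For all points A, B, C, X₁, X₂, X₃ ∈ ℝ² and every tropical line coefficient vector l ∈ ℝ³, define: lines L_{AB′} = L(A,X₁), L_{BC′} = L(B,X₂), L_{CA′} = L(C,X₃); points P = M(L_{AB′}, l), Q = M(L_{BC′}, l), R = M(L_{CA′}, l); lines L_{AC′} = L(A,R), L_{BA′} = L(B,P), L_{CB′} = L(C,Q); points A′ = M(L_{CA′}, L_{BA′}), B′ = M(L_{AB′}, L_{CB′}), C′ = M(L_{AC′}, L_{BC′}). Then there exists (c₂₀, c₀₂, c₁₁, c₁₀, c₀₁, c₀₀) ∈ ℝ⁶ such that each of the six points A, B, C, A′, B′, C′ lies on the tropical conic with these coefficients, i.e. at each of these points (x,y) the maximum max(c₂₀+2x, c₀₂+2y, c₁₁+x+y, c₁₀+x,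 c₀₁+y, c₀₀) is attained at least twice. -/
/-- The maximum of the finite family `f` is attained for at least two indices. -/
def attainedTwice {n : ℕ} (f : Fin n → ℝ) : Prop :=
  ∃ i j : Fin n, i ≠ j ∧ f i = f j ∧ ∀ l, f l ≤ f i

/-- The tropical line with coefficient vector `(α, β, γ)`. -/
def tropLineSet (a : ℝ × ℝ × ℝ) : Set (ℝ × ℝ) :=
  {p | attainedTwice ![a.1 + p.1, a.2.1 + p.2, a.2.2]}

/-- The tropical conic with coefficients `(c₂₀, c₀₂, c₁₁, c₁₀, c₀₁, c₀₀)`. -/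
def tropConicSet (c20 c02 c11 c10 c01 c00 : ℝ) : Set (ℝ × ℝ) :=
  {p | attainedTwice
    ![c20 + 2 * p.1, c02 + 2 * p.2, c11 + p.1 + p.2, c10 + p.1, c01 + p.2, c00]}

/-- Tropical Cramer rule: coefficient vector of the stable tropical line through two points. -/
noncomputable def Ltrop (p q : ℝ × ℝ) : ℝ × ℝ × ℝ :=
  (max p.2 q.2, max p.1 q.1, max (p.1 + q.2) (p.2 + q.1))

/-- Tropical Cramer rule: the stable intersection point of two tropical lines. -/
noncomputable def Mtrop (a b : ℝ × ℝ × ℝ) : ℝ × ℝ :=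
  (max (a.2.1 + b.2.2) (a.2.2 + b.2.1) - max (a.1 + b.2.1) (a.2.1 + b.1),
   max (a.1 + b.2.2) (a.2.2 + b.1) - max (a.1 + b.2.1) (a.2.1 + b.1))

open Matrix

/-- The tropical cross product: the Cramer rule of the max-plus semiring in homogeneous
coordinates. -/
def tropCross {Λ : Type*} [LinearOrder Λ] [Add Λ] (u v : Fin 3 → Λ) : Fin 3 → Λ :=
  ![max (u 1 + v 2) (u 2 + v 1), max (u 0 + v 2) (u 2 + v 0), max (u 0 + v 1) (u 1 + v 0)]

lemma exists_tropCross_apply_eq {Λ : Type*} [LinearOrder Λ] [Add Λ] (u v : Fin 3 → Λ)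
    (i : Fin 3) : ∃ a b, a ≠ b ∧ a ≠ i ∧ b ≠ i ∧ tropCross u v i = u a + v b := by
  fin_cases i
  · rcases max_choice (u 1 + v 2) (u 2 + v 1) with h | h
    exacts [⟨1, 2, by decide, by decide, by decide, h⟩, ⟨2, 1, by decide, by decide, by decide, h⟩]
  · rcases max_choice (u 0 + v 2) (u 2 + v 0) with h | h
    exacts [⟨0, 2, by decide, by decide, by decide, h⟩, ⟨2, 0, by decide, by decide, by decide, h⟩]
  · rcases max_choice (u 0 + v 1) (u 1 + v 0) with h | h
    exacts [⟨0, 1, by decide, by decide, by decide, h⟩, ⟨1, 0, by decide, by decide, by decide, h⟩]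

lemma map_tropCross {Λ Λ' : Type*} [LinearOrder Λ] [AddCommGroup Λ] [LinearOrder Λ']
    [AddCommGroup Λ'] (f : Λ →+ Λ') (hf : Monotone f) (u v : Fin 3 → Λ) :
    f ∘ tropCross u v = tropCross (f ∘ u) (f ∘ v) := by
  ext i
  fin_cases i <;> simp [tropCross, hf.map_max]

/-! ### Affine and homogeneous tropical coordinates -/

/-- The point of `ℝ²` with homogeneous tropical coordinates `w`. -/
def tropAffine (w : Fin 3 → ℝ) : ℝ × ℝ := (w 0 - w 2, w 1 - w 2)

lemma Ltrop_tropAffine (u v : Fin 3 → ℝ) :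
    Ltrop (tropAffine u) (tropAffine v) =
      (tropCross u v 0 - (u 2 + v 2), tropCross u v 1 - (u 2 + v 2),
        tropCross u v 2 - (u 2 + v 2)) := by
  simp only [Ltrop, tropAffine, tropCross, cons_val, ← max_sub_sub_right]
  congr 1
  · congr 1 <;> ring
  · congr 2 <;> ring

lemma Mtrop_sub (a b : Fin 3 → ℝ) (s t : ℝ) :
    Mtrop (a 0 - s, a 1 - s, a 2 - s) (b 0 - t, b 1 - t, b 2 - t) =
      tropAffine (tropCross a b) := by
  have h (i j k l : Fin 3) : max (a i - s + (b j - t)) (a k - s + (b l - t)) =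
      max (a i + b j) (a k + b l) - (s + t) := by
    rw [← max_sub_sub_right]; congr 1 <;> ring
  simp only [Mtrop, tropAffine, tropCross, cons_val, h, sub_sub_sub_cancel_right]

lemma Mtrop_Ltrop_left (u v w : Fin 3 → ℝ) :
    Mtrop (Ltrop (tropAffine u) (tropAffine v)) (w 0, w 1, w 2) =
      tropAffine (tropCross (tropCross u v) w) := by
  rw [Ltrop_tropAffine]
  simpa using Mtrop_sub (tropCross u v) w (u 2 + v 2) 0

lemma Mtrop_Ltrop_Ltrop (u v w x : Fin 3 → ℝ) :
    Mtrop (Ltrop (tropAffine u) (tropAffine v)) (Ltrop (tropAffine w) (tropAffine x)) =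
      tropAffine (tropCross (tropCross u v) (tropCross w x)) := by
  rw [Ltrop_tropAffine, Ltrop_tropAffine, Mtrop_sub]

/-- The tropical quadratic monomials, as linear forms in the homogeneous coordinates. -/
def tropMonomials {Λ : Type*} [Add Λ] (w : Fin 3 → Λ) : Fin 6 → Λ :=
  ![w 0 + w 0, w 1 + w 1, w 0 + w 1, w 0 + w 2, w 1 + w 2, w 2 + w 2]

lemma tropAffine_mem_tropConicSet {c : Fin 6 → ℝ} {w : Fin 3 → ℝ}
    (h : attainedTwice fun m => c m + tropMonomials w m) :
    tropAffine w ∈ tropConicSet (c 0) (c 1) (c 2) (c 3) (c 4) (c 5) := by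
  have key : (![c 0 + 2 * (tropAffine w).1, c 1 + 2 * (tropAffine w).2,
      c 2 + (tropAffine w).1 + (tropAffine w).2, c 3 + (tropAffine w).1,
      c 4 + (tropAffine w).2, c 5] : Fin 6 → ℝ) =
      fun m => c m + tropMonomials w m - 2 * w 2 := by
    ext m
    fin_cases m <;> simp [tropAffine, tropMonomials] <;> ring
  obtain ⟨i, j, hij, he, hl⟩ := h
  change attainedTwice _
  rw [key]
  exact ⟨i, j, hij, by simp only [he], fun l => sub_le_sub_right (hl l) _⟩

/-! ### Genericity -/

section Generic

variable {Γ ι : Type*} [AddCommGroup Γ]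

/-- The differences of distinct coordinates of `u` have nonzero image under `φ`, supported
in `s`. -/
def TropGeneric (φ : Γ →+ (ι → ℝ)) (s : Finset ι) (u : Fin 3 → Γ) : Prop :=
  ∀ i j, i ≠ j → φ (u i - u j) ≠ 0 ∧ ∀ k ∉ s, φ (u i - u j) k = 0

variable {φ : Γ →+ (ι → ℝ)} {s t : Finset ι} {u w : Fin 3 → Γ}

lemma TropGeneric.map_sub_apply (hu : TropGeneric φ s u) (i j : Fin 3) {k : ι} (hk : k ∉ s) :
    φ (u i - u j) k = 0 := by
  rcases eq_or_ne i j with rfl | h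
  · simp
  · exact (hu i j h).2 k hk

lemma TropGeneric.exists_mem (hu : TropGeneric φ s u) {i j : Fin 3} (h : i ≠ j) :
    ∃ k ∈ s, φ (u i - u j) k ≠ 0 := by
  obtain ⟨k, hk⟩ := Function.ne_iff.1 (hu i j h).1
  exact ⟨k, by_contra fun hs => hk ((hu i j h).2 k hs), hk⟩

lemma TropGeneric.map_add_sub_add_ne_zero (hu : TropGeneric φ s u) (hw : TropGeneric φ t w)
    (hst : Disjoint s t) {a b c d : Fin 3} (h : a ≠ c ∨ b ≠ d) :
    φ (u a + w b - (u c + w d)) ≠ 0 := by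
  rw [add_sub_add_comm, map_add]
  rcases h with h | h
  · obtain ⟨k, hk, hne⟩ := hu.exists_mem h
    refine fun h0 => hne ?_
    have := congrFun h0 k
    rwa [Pi.add_apply, hw.map_sub_apply b d (Finset.disjoint_left.1 hst hk),
      add_zero] at this
  · obtain ⟨k, hk, hne⟩ := hw.exists_mem h
    refine fun h0 => hne ?_
    have := congrFun h0 k
    rwa [Pi.add_apply, hu.map_sub_apply a c (Finset.disjoint_right.1 hst hk),
      zero_add] at this

lemma TropGeneric.add_ne_add (hu : TropGeneric φ s u) (hw : TropGeneric φ t w)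
    (hst : Disjoint s t) {a b c d : Fin 3} (h : a ≠ c ∨ b ≠ d) :
    u a + w b ≠ u c + w d := fun he =>
  hu.map_add_sub_add_ne_zero hw hst h (by rw [he, sub_self, map_zero])

lemma TropGeneric.tropCross [LinearOrder Γ] [DecidableEq ι] (hu : TropGeneric φ s u)
    (hw : TropGeneric φ t w) (hst : Disjoint s t) :
    TropGeneric φ (s ∪ t) (tropCross u w) := by
  intro i j hij
  obtain ⟨a, b, hab, hai, hbi, hi⟩ := exists_tropCross_apply_eq u w i
  obtain ⟨c, d, hcd, hcj, hdj, hj⟩ := exists_tropCross_apply_eq u w j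
  rw [hi, hj]
  refine ⟨hu.map_add_sub_add_ne_zero hw hst (by omega), fun k hk => ?_⟩
  rw [Finset.mem_union, not_or] at hk
  rw [add_sub_add_comm, map_add, Pi.add_apply, hu.map_sub_apply a c hk.1,
    hw.map_sub_apply b d hk.2, add_zero]

end Generic

/-! ### Lifting to a valued field -/

section Lift

variable {K Γ ι : Type*} [Field K] [AddCommGroup Γ] [LinearOrder Γ] [IsOrderedAddMonoid Γ]

/-- Every coordinate of `u` is the max-convention valuation of the corresponding coordinate
of `U`. -/
def IsTropLift {n : ℕ} (v : AddValuation K (WithTop Γ)) (U : Fin n → K) (u : Fin n → Γ) : Prop :=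
  ∀ i, v (U i) = ((-u i : Γ) : WithTop Γ)

variable {v : AddValuation K (WithTop Γ)}

lemma map_mul_eq_coe_neg {x y : K} {a b : Γ} (hx : v x = ((-a : Γ) : WithTop Γ))
    (hy : v y = ((-b : Γ) : WithTop Γ)) : v (x * y) = ((-(a + b) : Γ) : WithTop Γ) := by
  rw [v.map_mul, hx, hy, ← WithTop.coe_add, neg_add]

lemma map_sub_eq_coe_neg_max {x y : K} {a b : Γ} (hx : v x = ((-a : Γ) : WithTop Γ))
    (hy : v y = ((-b : Γ) : WithTop Γ)) (hab : a ≠ b) :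
    v (x - y) = ((-(max a b) : Γ) : WithTop Γ) := by
  rcases lt_or_gt_of_ne hab with h | h
  · rw [max_eq_right h.le, ← hy, v.map_sub_eq_of_lt_right]
    rw [hx, hy]; exact_mod_cast neg_lt_neg h
  · rw [max_eq_left h.le, ← hx, v.map_sub_eq_of_lt_left]
    rw [hx, hy]; exact_mod_cast neg_lt_neg h

/-- If a finite sum vanishes and not all terms do, then the least valuation of a term is
attained twice. -/
lemma exists_ne_map_eq_of_sum_eq_zero {α : Type*} [Fintype α] {x : α → K}
    (h0 : ∑ m, x m = 0) (hx : ∃ m, x m ≠ 0) :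
    ∃ i j, i ≠ j ∧ x i ≠ 0 ∧ v (x i) = v (x j) ∧ ∀ m, v (x i) ≤ v (x m) := by
  classical
  obtain ⟨m₀, hm₀⟩ := hx
  obtain ⟨i, -, hi⟩ := Finset.exists_min_image Finset.univ (fun m => v (x m)) ⟨m₀, by simp⟩
  have hi' (m : α) : v (x i) ≤ v (x m) := hi m (Finset.mem_univ m)
  have hne : x i ≠ 0 := fun h => hm₀ <| (v.top_iff).1 <| by
    simpa [h] using hi' m₀
  by_contra! hcon
  have hlt : v (x i) < v (∑ m ∈ Finset.univ.erase i, x m) := by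
    refine v.map_lt_sum (fun h => hne (v.top_iff.1 h)) fun m hm => ?_
    refine lt_of_le_of_ne (hi' m) fun he => ?_
    obtain ⟨k, hk⟩ := hcon i m (Finset.ne_of_mem_erase hm).symm hne he
    exact absurd (hi' k) (not_le.2 hk)
  have hsum : ∑ m ∈ Finset.univ.erase i, x m = -x i :=
    eq_neg_of_add_eq_zero_left (by rw [Finset.sum_erase_add _ _ (Finset.mem_univ i), h0])
  rw [hsum, v.map_neg] at hlt
  exact hlt.false

variable {φ : Γ →+ (ι → ℝ)} {s t : Finset ι} {U W : Fin 3 → K} {u w : Fin 3 → Γ}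

lemma IsTropLift.cross (hU : IsTropLift v U u) (hW : IsTropLift v W w)
    (hu : TropGeneric φ s u) (hw : TropGeneric φ t w) (hst : Disjoint s t) :
    IsTropLift v (U ⨯₃ W) (tropCross u w) := by
  have key (a b c d : Fin 3) (h : a ≠ c ∨ b ≠ d) :
      v (U a * W b - U c * W d) = ((-(max (u a + w b) (u c + w d)) : Γ) : WithTop Γ) :=
    map_sub_eq_coe_neg_max (map_mul_eq_coe_neg (hU a) (hW b)) (map_mul_eq_coe_neg (hU c) (hW d))
      (hu.add_ne_add hw hst h)
  intro i
  rw [cross_apply]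
  fin_cases i
  · exact key 1 2 2 1 (by decide)
  · change v (U 2 * W 0 - U 0 * W 2) = _
    rw [v.map_sub_swap]
    exact key 0 2 2 0 (by decide)
  · exact key 0 1 1 0 (by decide)

lemma IsTropLift.dotProduct_ne_zero (hU : IsTropLift v U u) (hW : IsTropLift v W w)
    (hu : TropGeneric φ s u) (hw : TropGeneric φ t w) (hst : Disjoint s t) :
    U ⬝ᵥ W ≠ 0 := by
  intro h0
  have hv (i : Fin 3) := map_mul_eq_coe_neg (hU i) (hW i)
  obtain ⟨i, j, hij, -, he, -⟩ := exists_ne_map_eq_of_sum_eq_zero (v := v) h0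
    ⟨0, fun h => WithTop.coe_ne_top (by rw [← hv 0, h, v.map_zero])⟩
  rw [hv, hv] at he
  exact hu.add_ne_add hw hst (Or.inl hij) (neg_injective (WithTop.coe_injective he))

/-- The quadratic monomials in the homogeneous coordinates. -/
def quadMonomials (w : Fin 3 → K) : Fin 6 → K :=
  ![w 0 * w 0, w 1 * w 1, w 0 * w 1, w 0 * w 2, w 1 * w 2, w 2 * w 2]

lemma IsTropLift.quadMonomials (hU : IsTropLift v U u) :
    IsTropLift v (quadMonomials U) (tropMonomials u) := by
  intro m
  fin_cases m <;> exact map_mul_eq_coe_neg (hU _) (hU _)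

/-- A nonzero vector in the kernel of a matrix with nonzero entries tropicalizes to a real vector
in the tropical kernel. -/
lemma exists_tropical_kernel {α : Type*} [Finite α] {n : ℕ} (π : Γ →+ ℝ) (hπ : Monotone π)
    {c : Fin n → K} (hc : c ≠ 0) {E : α → Fin n → K} {e : α → Fin n → Γ}
    (hE : ∀ j, IsTropLift v (E j) (e j)) (h0 : ∀ j, c ⬝ᵥ E j = 0) :
    ∃ γ : Fin n → ℝ, ∀ j, attainedTwice fun m => γ m + π (e j m) := by
  classical
  have hg (m : Fin n) : ∃ g : Γ, c m ≠ 0 → v (c m) = ((-g : Γ) : WithTop Γ) := by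
    by_cases h : c m = 0
    · exact ⟨0, fun h' => absurd h h'⟩
    · obtain ⟨a, ha⟩ := WithTop.ne_top_iff_exists.1 (fun h' => h (v.top_iff.1 h'))
      exact ⟨-a, fun _ => by rw [neg_neg, ha]⟩
  choose g hg using hg
  obtain ⟨m₀, hm₀⟩ := Function.ne_iff.1 hc
  obtain ⟨N, hN⟩ := Finite.bddBelow_range
    fun p : α × Fin n × Fin n => π (g p.2.1) + π (e p.1 p.2.1) - π (e p.1 p.2.2)
  have hN' (j m m') : N ≤ π (g m) + π (e j m) - π (e j m') := hN ⟨(j, m, m'), rfl⟩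
  have hv (j) {m} (hm : c m ≠ 0) : v (c m * E j m) = ((-(g m + e j m) : Γ) : WithTop Γ) :=
    map_mul_eq_coe_neg (hg m hm) (hE j m)
  refine ⟨fun m => if c m = 0 then N else π (g m), fun j => ?_⟩
  have hm₀' : c m₀ * E j m₀ ≠ 0 := fun h =>
    WithTop.coe_ne_top (by rw [← hv j hm₀, h, v.map_zero])
  obtain ⟨a, b, hab, hane, he, hle⟩ :=
    exists_ne_map_eq_of_sum_eq_zero (v := v) (h0 j) ⟨m₀, hm₀'⟩
  have ha : c a ≠ 0 := left_ne_zero_of_mul hane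
  have hb : c b ≠ 0 := fun h => hane <| v.top_iff.1 <| by simpa [h] using he
  refine ⟨a, b, hab, ?_, fun m => ?_⟩
  · rw [hv j ha, hv j hb] at he
    simp only [ha, hb, if_false]
    rw [← map_add, ← map_add, neg_injective (WithTop.coe_injective he)]
  · simp only [ha, if_false]
    split_ifs with hm
    · linarith [hN' j a m]
    · have := hle m
      rw [hv j ha, hv j hm, WithTop.coe_le_coe, neg_le_neg_iff] at this
      simpa using hπ this

/-- A conic over `K` through points with given tropicalizations tropicalizes to a real conic
through the real parts of these tropicalizations. -/
lemma exists_tropConicSet_of_lift {α : Type*} [Finite α] (π : Γ →+ ℝ) (hπ : Monotone π)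
    {c : Fin 6 → K} (hc : c ≠ 0) {W : α → Fin 3 → K} {w : α → Fin 3 → Γ}
    (hW : ∀ j, IsTropLift v (W j) (w j)) (h0 : ∀ j, c ⬝ᵥ quadMonomials (W j) = 0) :
    ∃ c20 c02 c11 c10 c01 c00 : ℝ, ∀ j,
      tropAffine (π ∘ w j) ∈ tropConicSet c20 c02 c11 c10 c01 c00 := by
  obtain ⟨γ, hγ⟩ := exists_tropical_kernel π hπ hc (fun j => (hW j).quadMonomials) h0
  refine ⟨_, _, _, _, _, _, fun j => tropAffine_mem_tropConicSet (c := γ) ?_⟩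
  convert hγ j using 3 with m
  fin_cases m <;> simp [tropMonomials]

end Lift

/-! ### The converse of Pascal's theorem over a field -/

section Pascal

variable {K : Type*} [Field K]

/-- The coefficients of the product of two linear forms. -/
def conicOfLines (r s : Fin 3 → K) : Fin 6 → K :=
  ![r 0 * s 0, r 1 * s 1, r 0 * s 1 + r 1 * s 0, r 0 * s 2 + r 2 * s 0, r 1 * s 2 + r 2 * s 1,
    r 2 * s 2]

lemma conicOfLines_dotProduct (r s w : Fin 3 → K) :
    conicOfLines r s ⬝ᵥ quadMonomials w = (r ⬝ᵥ w) * (s ⬝ᵥ w) := by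
  simp [conicOfLines, quadMonomials, dotProduct, Fin.sum_univ_succ]
  ring

lemma cross_cross_dotProduct (b L l w : Fin 3 → K) :
    (b ⨯₃ (L ⨯₃ l)) ⬝ᵥ w = (b ⬝ᵥ l) * (L ⬝ᵥ w) - (L ⬝ᵥ b) * (l ⬝ᵥ w) := by
  simp [cross_apply, dotProduct, Fin.sum_univ_succ]
  ring

/-- The constructive converse of Pascal's theorem: if the pairs of opposite sides of the hexagon
`A B₁ C A₁ B C₁` meet on the line `l`, then its vertices lie on a conic. -/
lemma exists_conic_of_hexagon {A B C X₁ X₂ X₃ l : Fin 3 → K}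
    (hB : (A ⨯₃ X₁) ⬝ᵥ B ≠ 0) (h₂ : (C ⨯₃ ((B ⨯₃ X₂) ⨯₃ l)) ⬝ᵥ X₁ ≠ 0)
    (h₃ : (A ⨯₃ ((C ⨯₃ X₃) ⨯₃ l)) ⬝ᵥ X₁ ≠ 0) :
    ∃ c : Fin 6 → K, c ≠ 0 ∧ c ⬝ᵥ quadMonomials A = 0 ∧ c ⬝ᵥ quadMonomials B = 0 ∧
      c ⬝ᵥ quadMonomials C = 0 ∧
      c ⬝ᵥ quadMonomials ((C ⨯₃ X₃) ⨯₃ (B ⨯₃ ((A ⨯₃ X₁) ⨯₃ l))) = 0 ∧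
      c ⬝ᵥ quadMonomials ((A ⨯₃ X₁) ⨯₃ (C ⨯₃ ((B ⨯₃ X₂) ⨯₃ l))) = 0 ∧
      c ⬝ᵥ quadMonomials ((A ⨯₃ ((C ⨯₃ X₃) ⨯₃ l)) ⨯₃ (B ⨯₃ X₂)) = 0 := by
  have hM₁ := cross_cross_dotProduct B (A ⨯₃ X₁) l
  have hM₂ := cross_cross_dotProduct C (B ⨯₃ X₂) l
  have hM₃ := cross_cross_dotProduct A (C ⨯₃ X₃) l
  have left (x y : Fin 3 → K) : (x ⨯₃ y) ⬝ᵥ x = 0 := by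
    rw [dotProduct_comm, dot_self_cross]
  have right (x y : Fin 3 → K) : (x ⨯₃ y) ⬝ᵥ y = 0 := by
    rw [dotProduct_comm, dot_cross_self]
  have hL₁A := left A X₁
  have hL₁X := right A X₁
  have hL₂B := left B X₂
  have hL₃C := left C X₃
  have hM₁B := left B ((A ⨯₃ X₁) ⨯₃ l)
  have hM₂C := left C ((B ⨯₃ X₂) ⨯₃ l)
  have hM₃A := left A ((C ⨯₃ X₃) ⨯₃ l)
  set L₁ := A ⨯₃ X₁
  set L₂ := B ⨯₃ X₂
  set L₃ := C ⨯₃ X₃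
  set M₁ := B ⨯₃ (L₁ ⨯₃ l)
  set M₂ := C ⨯₃ (L₂ ⨯₃ l)
  set M₃ := A ⨯₃ (L₃ ⨯₃ l)
  let c : Fin 6 → K := -(L₁ ⬝ᵥ B) • conicOfLines M₂ M₃ -
    ((B ⬝ᵥ l) * (L₂ ⬝ᵥ C)) • conicOfLines L₁ M₃ -
    ((B ⬝ᵥ l) * (C ⬝ᵥ l) * (L₃ ⬝ᵥ A)) • conicOfLines L₁ L₂
  have hc (w : Fin 3 → K) : c ⬝ᵥ quadMonomials w =
      -(L₁ ⬝ᵥ B) * ((M₂ ⬝ᵥ w) * (M₃ ⬝ᵥ w)) -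
      (B ⬝ᵥ l) * (L₂ ⬝ᵥ C) * ((L₁ ⬝ᵥ w) * (M₃ ⬝ᵥ w)) -
      (B ⬝ᵥ l) * (C ⬝ᵥ l) * (L₃ ⬝ᵥ A) * ((L₁ ⬝ᵥ w) * (L₂ ⬝ᵥ w)) := by
    simp only [c, sub_dotProduct, smul_dotProduct, conicOfLines_dotProduct, smul_eq_mul]
  have of_L₁ (w) (h : L₁ ⬝ᵥ w = 0) (h' : M₂ ⬝ᵥ w = 0 ∨ M₃ ⬝ᵥ w = 0) :
      c ⬝ᵥ quadMonomials w = 0 := by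
    rw [hc, h]; rcases h' with h' | h' <;> rw [h'] <;> ring
  have of_M₁_L₂ (w) (h : M₁ ⬝ᵥ w = 0) (h' : L₂ ⬝ᵥ w = 0) : c ⬝ᵥ quadMonomials w = 0 := by
    have h₁ := hM₁ w
    have h₂ := hM₂ w
    rw [hc, h₂, h']
    linear_combination (L₂ ⬝ᵥ C) * (M₃ ⬝ᵥ w) * (h₁ - h)
  have of_L₃ (w) (h : L₃ ⬝ᵥ w = 0) (h' : M₁ ⬝ᵥ w = 0 ∨ M₂ ⬝ᵥ w = 0) :
      c ⬝ᵥ quadMonomials w = 0 := by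
    have h₁ := hM₁ w
    have h₂ := hM₂ w
    have h₃ := hM₃ w
    have : c ⬝ᵥ quadMonomials w = -(L₃ ⬝ᵥ A) * ((M₁ ⬝ᵥ w) * (M₂ ⬝ᵥ w)) := by
      rw [hc, h₁, h₂, h₃, h]; ring
    rw [this]; rcases h' with h' | h' <;> rw [h'] <;> ring
  have of_M₃_L₂ (w) (h : M₃ ⬝ᵥ w = 0) (h' : L₂ ⬝ᵥ w = 0) : c ⬝ᵥ quadMonomials w = 0 := by
    rw [hc, h, h']; ring
  refine ⟨c, fun h => ?_, of_L₁ A hL₁A (.inr hM₃A), of_M₁_L₂ B hM₁B hL₂B,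
    of_L₃ C hL₃C (.inr hM₂C), of_L₃ _ (dot_self_cross _ _) (.inl (dot_cross_self _ _)),
    of_L₁ _ (dot_self_cross _ _) (.inl (dot_cross_self _ _)), of_M₃_L₂ _ (dot_self_cross _ _) (dot_cross_self _ _)⟩
  have hX := hc X₁
  rw [h, zero_dotProduct, hL₁X] at hX
  refine mul_ne_zero (neg_ne_zero.2 hB) (mul_ne_zero h₂ h₃) ?_
  linear_combination -hX

end Pascal

/-! ### Infinitesimal perturbations -/

/-- The value group: real numbers with seven independent infinitesimals. -/
abbrev PerturbedReal : Type := ℝ ×ₗ Lex (Fin 7 → ℝ)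

/-- The real part. -/
def PerturbedReal.re : PerturbedReal →+ ℝ where
  toFun x := (ofLex x).1
  map_zero' := rfl
  map_add' _ _ := rfl

lemma PerturbedReal.re_monotone : Monotone PerturbedReal.re := Prod.Lex.monotone_fst_ofLex

/-- The infinitesimal part. -/
def PerturbedReal.infinitesimal : PerturbedReal →+ (Fin 7 → ℝ) where
  toFun x := ofLex (ofLex x).2
  map_zero' := rfl
  map_add' _ _ := rfl

/-- Perturb a vector in the direction of the `k`-th infinitesimal. -/
def perturb (k : Fin 7) (x : Fin 3 → ℝ) (i : Fin 3) : PerturbedReal :=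
  toLex (x i, toLex (Pi.single k (i : ℝ)))

lemma re_comp_perturb (k : Fin 7) (x : Fin 3 → ℝ) : PerturbedReal.re ∘ perturb k x = x := rfl

lemma tropGeneric_perturb (k : Fin 7) (x : Fin 3 → ℝ) :
    TropGeneric PerturbedReal.infinitesimal {k} (perturb k x) := by
  intro i j hij
  have h : PerturbedReal.infinitesimal (perturb k x i - perturb k x j) =
      Pi.single k ((i : ℝ) - (j : ℝ)) := by
    rw [Pi.single_sub]; rfl
  rw [h]
  refine ⟨?_, fun m hm => Pi.single_eq_of_ne (by simpa using hm) _⟩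
  rw [Ne, Pi.single_eq_zero_iff, sub_eq_zero, Nat.cast_inj]
  exact fun h => hij (Fin.ext h)

/-- The vector of monomials in the field of Hahn series with exponents `-u`. -/
noncomputable def hahnLift (u : Fin 3 → PerturbedReal) (i : Fin 3) : HahnSeries PerturbedReal ℚ :=
  HahnSeries.single (-u i) 1

lemma isTropLift_hahnLift (u : Fin 3 → PerturbedReal) :
    IsTropLift (HahnSeries.addVal PerturbedReal ℚ) (hahnLift u) u := by
  intro i
  rw [HahnSeries.addVal_apply, hahnLift, HahnSeries.orderTop_single one_ne_zero]

/-- constructive tropical converse Pascal theorem.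
With `L_{AB′} = L(A,X₁)`, `L_{BC′} = L(B,X₂)`, `L_{CA′} = L(C,X₃)`,
`P = M(L_{AB′}, l)`, `Q = M(L_{BC′}, l)`, `R = M(L_{CA′}, l)`,
`L_{AC′} = L(A,R)`, `L_{BA′} = L(B,P)`, `L_{CB′} = L(C,Q)`,
`A′ = M(L_{CA′}, L_{BA′})`, `B′ = M(L_{AB′}, L_{CB′})`, `C′ = M(L_{AC′}, L_{BC′})`,
the six points `A, B, C, A′, B′, C′` lie on a common tropical conic. -/
theorem tropical_converse_pascal (A B C X1 X2 X3 : ℝ × ℝ) (l : ℝ × ℝ × ℝ) :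
    ∃ c20 c02 c11 c10 c01 c00 : ℝ,
      A ∈ tropConicSet c20 c02 c11 c10 c01 c00 ∧
      B ∈ tropConicSet c20 c02 c11 c10 c01 c00 ∧
      C ∈ tropConicSet c20 c02 c11 c10 c01 c00 ∧
      Mtrop (Ltrop C X3) (Ltrop B (Mtrop (Ltrop A X1) l)) ∈
        tropConicSet c20 c02 c11 c10 c01 c00 ∧
      Mtrop (Ltrop A X1) (Ltrop C (Mtrop (Ltrop B X2) l)) ∈
        tropConicSet c20 c02 c11 c10 c01 c00 ∧
      Mtrop (Ltrop A (Mtrop (Ltrop C X3) l)) (Ltrop B X2) ∈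
        tropConicSet c20 c02 c11 c10 c01 c00 := by
  have haff (p : ℝ × ℝ) : ∃ w, tropAffine w = p := ⟨![p.1, p.2, 0], by simp [tropAffine]⟩
  obtain ⟨⟨A, rfl⟩, ⟨B, rfl⟩, ⟨C, rfl⟩⟩ := haff A, haff B, haff C
  obtain ⟨⟨X1, rfl⟩, ⟨X2, rfl⟩, ⟨X3, rfl⟩⟩ := haff X1, haff X2, haff X3
  obtain ⟨l, rfl⟩ : ∃ w : Fin 3 → ℝ, (w 0, w 1, w 2) = l := ⟨![l.1, l.2.1, l.2.2], rfl⟩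
  simp only [Mtrop_Ltrop_left, Mtrop_Ltrop_Ltrop]
  have gen := tropGeneric_perturb
  have lift (k x) := isTropLift_hahnLift (perturb k x)
  have gL₁ := (gen 0 A).tropCross (gen 3 X1) (by decide)
  have gL₂ := (gen 1 B).tropCross (gen 4 X2) (by decide)
  have gL₃ := (gen 2 C).tropCross (gen 5 X3) (by decide)
  have gP := gL₁.tropCross (gen 6 l) (by decide)
  have gQ := gL₂.tropCross (gen 6 l) (by decide)
  have gR := gL₃.tropCross (gen 6 l) (by decide)
  have gM₁ := (gen 1 B).tropCross gP (by decide)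
  have gM₂ := (gen 2 C).tropCross gQ (by decide)
  have gM₃ := (gen 0 A).tropCross gR (by decide)
  have tL₁ := (lift 0 A).cross (lift 3 X1) (gen 0 A) (gen 3 X1) (by decide)
  have tL₂ := (lift 1 B).cross (lift 4 X2) (gen 1 B) (gen 4 X2) (by decide)
  have tL₃ := (lift 2 C).cross (lift 5 X3) (gen 2 C) (gen 5 X3) (by decide)
  have tM₁ := (lift 1 B).cross (tL₁.cross (lift 6 l) gL₁ (gen 6 l) (by decide))
    (gen 1 B) gP (by decide)
  have tM₂ := (lift 2 C).cross (tL₂.cross (lift 6 l) gL₂ (gen 6 l) (by decide))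
    (gen 2 C) gQ (by decide)
  have tM₃ := (lift 0 A).cross (tL₃.cross (lift 6 l) gL₃ (gen 6 l) (by decide))
    (gen 0 A) gR (by decide)
  obtain ⟨c, hc, hA, hB, hC, hA', hB', hC'⟩ := exists_conic_of_hexagon
    (tL₁.dotProduct_ne_zero (lift 1 B) gL₁ (gen 1 B) (by decide))
    (tM₂.dotProduct_ne_zero (lift 3 X1) gM₂ (gen 3 X1) (by decide))
    (tM₃.dotProduct_ne_zero (lift 3 X1) gM₃ (gen 3 X1) (by decide))
  have tA' := tL₃.cross tM₁ gL₃ gM₁ (by decide)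
  have tB' := tL₁.cross tM₂ gL₁ gM₂ (by decide)
  have tC' := tM₃.cross tL₂ gM₃ gL₂ (by decide)
  obtain ⟨c20, c02, c11, c10, c01, c00, h⟩ :=
    exists_tropConicSet_of_lift PerturbedReal.re PerturbedReal.re_monotone hc
      (W := ![_, _, _, _, _, _])
      (w := ![perturb 0 A, perturb 1 B, perturb 2 C,
        tropCross (tropCross (perturb 2 C) (perturb 5 X3))
          (tropCross (perturb 1 B) (tropCross (tropCross (perturb 0 A) (perturb 3 X1))
            (perturb 6 l))),
        tropCross (tropCross (perturb 0 A) (perturb 3 X1))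
          (tropCross (perturb 2 C) (tropCross (tropCross (perturb 1 B) (perturb 4 X2))
            (perturb 6 l))),
        tropCross (tropCross (perturb 0 A) (tropCross (tropCross (perturb 2 C) (perturb 5 X3))
          (perturb 6 l))) (tropCross (perturb 1 B) (perturb 4 X2))])
      (by
        simp only [Fin.forall_fin_succ, IsEmpty.forall_iff, and_true]
        exact ⟨lift 0 A, lift 1 B, lift 2 C, tA', tB', tC'⟩)
      (by
        simp only [Fin.forall_fin_succ, IsEmpty.forall_iff, and_true]
        exact ⟨hA, hB, hC, hA', hB', hC'⟩)
  simp only [Fin.forall_fin_succ, IsEmpty.forall_iff, and_true, cons_val_zero, cons_val_succ,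
    map_tropCross _ PerturbedReal.re_monotone, re_comp_perturb] at h
  exact ⟨c20, c02, c11, c10, c01, c00, h⟩
end
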